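/- Let f be a bounded measurable real-valued function on the circle S¹ with f(θ) > 0 for Lebesgue-almost every θ, and let a_j be its Fourier coefficients. Then the smallest eigenvalue of the Hermitian Toeplitz matrix T_k[a] decays subexponentially: log(λ_min(T_k[a]))/k → 0 as k → ∞; equivalently, for every ε > 0 there is k₀ ∈ ℕ such that exp(−ε·k) ≤ λ_min(T_k[a]) ≤ exp(ε·k) for all k ≥ k₀. -/

import Mathlib

open MeasureTheory Matrix

/-- The `j`-th Fourier coefficient `a_j = (1/2π) ∫₀^{2π} f(θ) e^{-ijθ} dθ` of a
real-valued function on the circle `ℝ/2πℤ`. -/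
noncomputable def fourierCoefR (f : ℝ → ℝ) (j : ℤ) : ℂ :=
  (1 / (2 * (Real.pi : ℂ))) *
    ∫ θ in (0 : ℝ)..(2 * Real.pi), (f θ : ℂ) * Complex.exp (-(Complex.I * (j : ℂ) * (θ : ℂ)))

/-- The `(k+1) × (k+1)` Toeplitz matrix `(a_{p-q})_{0 ≤ p,q ≤ k}` associated with the
Fourier coefficients of `f`. -/
noncomputable def toeplitzMatR (f : ℝ → ℝ) (k : ℕ) :
    Matrix (Fin (k + 1)) (Fin (k + 1)) ℂ :=
  Matrix.of fun p q => fourierCoefR f ((p : ℤ) - (q : ℤ))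

/-- The smallest eigenvalue of a Hermitian matrix, expressed as the infimum of the
Rayleigh quotient over the unit sphere. -/
noncomputable def lambdaMin {n : ℕ} (M : Matrix (Fin n) (Fin n) ℂ) : ℝ :=
  sInf {t : ℝ | ∃ v : Fin n → ℂ, (∑ i, ‖v i‖ ^ 2) = 1 ∧
    t = (dotProduct (star v) (M.mulVec v)).re}


open Polynomial in
lemma reflect_roots (r : ℝ) (hr0 : 0 < r) (hr1 : r < 1) (z₀ : ℂ) (hz₀ : ‖z₀‖ = 1)
    (s : Multiset ℂ) (hs : ∀ a ∈ s, ‖a‖ ≠ 1) :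
    ∃ Q : ℂ[X], (∀ z : ℂ, ‖z‖ = 1 → ‖Q.eval z‖ = ‖((s.map fun a => X - C a).prod).eval z‖) ∧
      (∀ z : ℂ, ‖z‖ ≤ 1 → Q.eval z ≠ 0) ∧
      r ^ (Multiset.card s) * ‖((s.map fun a => X - C a).prod).eval z₀‖ ^ 2
        ≤ ‖Q.eval (r * z₀)‖ ^ 2 := by
  induction s using Multiset.induction_on with
  | empty => exact ⟨1, by simp, by simp, by simp⟩
  | cons a s ih =>
    obtain ⟨Q, h1, h2, h3⟩ := ih (fun b hb => hs b (Multiset.mem_cons_of_mem hb))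
    have ha := hs a (Multiset.mem_cons_self a s)
    obtain ⟨q, g1, g2, g3⟩ : ∃ q : ℂ[X], (∀ z : ℂ, ‖z‖ = 1 → ‖q.eval z‖ = ‖z - a‖) ∧
        (∀ z : ℂ, ‖z‖ ≤ 1 → q.eval z ≠ 0) ∧ r * ‖z₀ - a‖ ^ 2 ≤ ‖q.eval (r * z₀)‖ ^ 2 := by
      have hz2 : z₀.re * z₀.re + z₀.im * z₀.im = 1 := by
        have := Complex.sq_norm z₀
        rw [hz₀, Complex.normSq_apply] at this; linarith
      have ha2 := Complex.sq_norm a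
      rw [Complex.normSq_apply] at ha2
      rcases lt_or_gt_of_ne ha with h | h
      · refine ⟨1 - C (starRingEnd ℂ a) * X, ?_, ?_, ?_⟩
        · intro z hz
          have : z - a = z * starRingEnd ℂ (1 - (starRingEnd ℂ a) * z) := by
            have : z * starRingEnd ℂ z = 1 := by
              rw [Complex.mul_conj, Complex.normSq_eq_norm_sq, hz]; simp
            simp only [map_sub, map_one, map_mul, Complex.conj_conj]
            linear_combination a * this
          rw [this, norm_mul, hz, one_mul, Complex.norm_conj]
          simp
        · intro z hz h0
          have h0' : (1:ℂ) = starRingEnd ℂ a * z := by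
            simpa [sub_eq_zero] using h0
          have := congrArg norm h0'
          rw [norm_mul, Complex.norm_conj, norm_one] at this
          nlinarith [norm_nonneg a, norm_nonneg z]
        · have hsq : ‖a‖ ^ 2 ≤ 1 := by nlinarith [norm_nonneg a]
          rw [ha2] at hsq
          simp only [Complex.sq_norm, Complex.normSq_apply]
          simp only [eval_sub, eval_one, eval_mul, eval_C, eval_X, Complex.sub_re, Complex.sub_im,
            Complex.mul_re, Complex.mul_im, Complex.conj_re, Complex.conj_im, Complex.ofReal_re,
            Complex.ofReal_im, Complex.one_re, Complex.one_im]
          have key : (1 - r) * (1 - r * (a.re * a.re + a.im * a.im)) ≥ 0 :=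
            mul_nonneg (by linarith) (by nlinarith)
          linear_combination key + (r - r ^ 2 * (a.re * a.re + a.im * a.im)) * hz2
      · refine ⟨X - C a, by simp, ?_, ?_⟩
        · intro z hz h0
          have h0' : z = a := by simpa [sub_eq_zero] using h0
          rw [h0'] at hz; linarith
        · have hsq : 1 ≤ ‖a‖ ^ 2 := by nlinarith [norm_nonneg a]
          rw [ha2] at hsq
          simp only [Complex.sq_norm, Complex.normSq_apply]
          simp only [eval_sub, eval_C, eval_X, Complex.sub_re, Complex.sub_im,
            Complex.mul_re, Complex.mul_im, Complex.ofReal_re,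
            Complex.ofReal_im]
          have key : (1 - r) * ((a.re * a.re + a.im * a.im) - r) ≥ 0 :=
            mul_nonneg (by linarith) (by nlinarith)
          linear_combination key + (r - r ^ 2) * hz2
    refine ⟨q * Q, ?_, ?_, ?_⟩
    · intro z hz
      simp [g1 z hz, h1 z hz]
    · intro z hz
      simp [g2 z hz, h2 z hz]
    · simp only [Multiset.map_cons, Multiset.prod_cons, eval_mul, eval_sub, eval_X, eval_C,
        norm_mul, mul_pow, Multiset.card_cons, pow_succ r]
      calc _ = (r * ‖z₀ - a‖ ^ 2) * (r ^ Multiset.card s *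
          ‖((s.map fun a => X - C a).prod).eval z₀‖ ^ 2) := by ring
        _ ≤ _ := by gcongr

open Polynomial in
lemma poisson_log_lower (r : ℝ) (hr0 : 0 < r) (hr1 : r < 1) (z₀ : ℂ) (hz₀ : ‖z₀‖ = 1)
    (k : ℕ) (P : ℂ[X]) (hk : P.natDegree ≤ k) (hP : ∀ z : ℂ, ‖z‖ = 1 → P.eval z ≠ 0) :
    k * Real.log r + 2 * Real.log ‖P.eval z₀‖ ≤
      2 * Real.circleAverage (poissonKernel 0 (r * z₀) • fun z => Real.log ‖P.eval z‖) 0 1 := by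
  have hP0 : P ≠ 0 := by
    rintro rfl; exact hP 1 (by simp) (by simp)
  obtain ⟨Q, h1, h2, h3⟩ := reflect_roots r hr0 hr1 z₀ hz₀ P.roots (fun a ha h => hP a h
    ((mem_roots hP0).1 ha))
  have hfac : P = C P.leadingCoeff * (P.roots.map fun a => X - C a).prod :=
    (IsAlgClosed.splits P).eq_prod_roots
  set R := (P.roots.map fun a => X - C a).prod with hR
  have hlc : P.leadingCoeff ≠ 0 := by simpa using hP0
  set b := P.leadingCoeff
  have hev : ∀ z, P.eval z = b * R.eval z := by
    intro z; conv_lhs => rw [hfac]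
    simp
  have hw : (r * z₀ : ℂ) ∈ Metric.ball (0:ℂ) 1 := by
    simp [hz₀, abs_of_pos hr0, hr1]
  have hharm : InnerProductSpace.HarmonicOnNhd (fun z => Real.log ‖(C b * Q).eval z‖)
      (Metric.closedBall 0 1) := by
    intro z hz
    apply AnalyticAt.harmonicAt_log_norm
    · exact (C b * Q).differentiable.analyticAt z
    · have := h2 z (by simpa using hz)
      simp [hlc, this]
  have := hharm.circleAverage_poissonKernel_smul hw
  have hcong : Real.circleAverage (poissonKernel 0 (r * z₀) • fun z => Real.log ‖P.eval z‖) 0 1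
      = Real.circleAverage (poissonKernel 0 (r * z₀) • fun z => Real.log ‖(C b * Q).eval z‖) 0 1 := by
    apply Real.circleAverage_congr_sphere
    intro z hz
    have hz : ‖z‖ = 1 := by simpa using hz
    simp [hev, h1 z hz]
  rw [hcong, this]
  have hRz : R.eval z₀ ≠ 0 := by
    intro h; apply hP z₀ hz₀; rw [hev, h, mul_zero]
  have hcard : Multiset.card P.roots ≤ k := (card_roots' P).trans hk
  have h4 : r ^ k * ‖R.eval z₀‖ ^ 2 ≤ ‖Q.eval (r * z₀)‖ ^ 2 := by
    refine le_trans ?_ h3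
    gcongr ?_ * _
    exact pow_le_pow_of_le_one hr0.le hr1.le hcard
  have h5 : r ^ k * ‖P.eval z₀‖ ^ 2 ≤ ‖(C b * Q).eval (r * z₀)‖ ^ 2 := by
    rw [hev]
    simp only [eval_mul, eval_C, norm_mul, mul_pow]
    nlinarith [sq_nonneg ‖b‖]
  have hpos : 0 < ‖P.eval z₀‖ := norm_pos_iff.2 (hP z₀ hz₀)
  have h6 := Real.log_le_log (by positivity) h5
  rw [Real.log_mul (by positivity) (by positivity), Real.log_pow, Real.log_pow, Real.log_pow] at h6
  simpa using h6

lemma exists_small_level (f : ℝ → ℝ) (hmeas : Measurable f)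
    (hpos : ∀ᵐ θ ∂(volume.restrict (Set.Ioo (0 : ℝ) (2 * Real.pi))), 0 < f θ)
    (δ : ℝ) (hδ : 0 < δ) :
    ∃ c > (0:ℝ), ∫ θ in (0:ℝ)..(2 * Real.pi), (if f θ < c then (1:ℝ) else 0) ≤ δ := by
  have hpos' : ∀ᵐ θ ∂(volume : Measure ℝ), θ ∈ Set.uIoc (0:ℝ) (2 * Real.pi) → 0 < f θ := by
    rw [restrict_Ioo_eq_restrict_Ioc] at hpos
    rw [Set.uIoc_of_le (by positivity)]
    exact (ae_restrict_iff' measurableSet_Ioc).1 hpos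
  have ht : Filter.Tendsto (fun n : ℕ => ∫ θ in (0:ℝ)..(2 * Real.pi),
      (if f θ < 1 / ((n:ℝ) + 1) then (1:ℝ) else 0)) Filter.atTop
      (nhds (∫ θ in (0:ℝ)..(2 * Real.pi), (0:ℝ))) := by
    apply intervalIntegral.tendsto_integral_filter_of_dominated_convergence (fun _ => (1:ℝ))
    · refine Filter.Eventually.of_forall fun n => ?_
      exact (Measurable.ite (measurableSet_lt hmeas measurable_const) measurable_const
        measurable_const).aestronglyMeasurable
    · refine Filter.Eventually.of_forall fun n => ?_
      refine Filter.Eventually.of_forall fun θ _ => ?_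
      split_ifs <;> simp
    · simp
    · filter_upwards [hpos'] with θ hθ hm
      have := (tendsto_order.1 tendsto_one_div_add_atTop_nhds_zero_nat).2 (f θ) (hθ hm)
      apply tendsto_const_nhds.congr'
      filter_upwards [this] with n hn
      rw [if_neg (by linarith)]
  rw [intervalIntegral.integral_zero] at ht
  obtain ⟨n, hn⟩ := ((tendsto_order.1 ht).2 δ hδ).exists
  exact ⟨1 / ((n:ℝ) + 1), by positivity, hn.le⟩

open Polynomial in
lemma integral_lower (f : ℝ → ℝ) (hmeas : Measurable f)
    (hbd : ∃ C : ℝ, ∀ θ : ℝ, |f θ| ≤ C)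
    (hpos : ∀ᵐ θ ∂(volume.restrict (Set.Ioo (0 : ℝ) (2 * Real.pi))), 0 < f θ)
    (r : ℝ) (hr0 : 0 < r) (hr1 : r < 1) :
    ∃ c₀ > (0:ℝ), ∀ k : ℕ, 1 ≤ k → ∀ P : ℂ[X], P.natDegree ≤ k →
      (∀ z : ℂ, ‖z‖ = 1 → P.eval z ≠ 0) → ∀ z₀ : ℂ, ‖z₀‖ = 1 →
      (∀ z : ℂ, ‖z‖ = 1 → ‖P.eval z‖ ≤ ‖P.eval z₀‖) →
      c₀ * r ^ (4 * k) * ‖P.eval z₀‖ ^ 2 ≤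
        (2 * Real.pi)⁻¹ * ∫ θ in (0:ℝ)..(2 * Real.pi), f θ * ‖P.eval (circleMap 0 1 θ)‖ ^ 2 := by
  obtain ⟨Cf, hCf⟩ := hbd
  set B : ℝ := (1 + r) / (1 - r) with hB
  have hBpos : 0 < B := div_pos (by linarith) (by linarith)
  have hpi := Real.pi_pos
  obtain ⟨c, hc, hcint⟩ := exists_small_level f hmeas hpos (2 * Real.pi / (4 * B)) (by positivity)
  refine ⟨c / (2 * B), by positivity, ?_⟩
  intro k hk P hdeg hP z₀ hz₀ hmax
  have hpl := poisson_log_lower r hr0 hr1 z₀ hz₀ k P hdeg hP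
  set M := ‖P.eval z₀‖ with hM
  have hMpos : 0 < M := norm_pos_iff.2 (hP z₀ hz₀)
  have hce : ∀ θ, ‖circleMap 0 1 θ‖ = 1 := by intro θ; simp
  have hwmem : (r * z₀ : ℂ) ∈ Metric.ball (0:ℂ) 1 := by
    simp [hz₀, abs_of_pos hr0, hr1]
  have hwnorm : ‖(r * z₀ : ℂ)‖ = r := by simp [hz₀, abs_of_pos hr0]
  set w : ℝ → ℝ := fun θ => poissonKernel 0 (r * z₀) (circleMap 0 1 θ) with hw
  have hwB : ∀ θ, w θ ≤ B := by
    intro θ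
    have := re_herglotzRieszKernel_le (c := 0) (R := 1) (z := circleMap 0 1 θ)
      (w := (r * z₀ : ℂ)) (by simp) hwmem
    simp only [hw, poissonKernel_eq_re_herglotzRieszKernel, Function.comp, herglotzRieszKernel]
    simpa [hwnorm, hB, hz₀, abs_of_pos hr0] using this
  have hw0 : ∀ θ, 0 ≤ w θ := by
    intro θ
    simp only [hw, poissonKernel_def, sub_zero, hce, hwnorm]
    exact div_nonneg (by nlinarith) (by positivity)
  have hwc : Continuous w := by
    simp only [hw, poissonKernel_def, sub_zero, hce, hwnorm]
    apply Continuous.div continuous_const (by fun_prop)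
    intro θ h
    have h' : circleMap 0 1 θ = r * z₀ := by simpa [sub_eq_zero] using h
    have := congrArg norm h'
    rw [hce, hwnorm] at this; linarith
  have hw1 : (2 * Real.pi)⁻¹ * ∫ θ in (0:ℝ)..(2 * Real.pi), w θ = 1 := by
    have hh : InnerProductSpace.HarmonicOnNhd (fun _ : ℂ => (1:ℝ)) (Metric.closedBall 0 1) := by
      intro z _
      have := AnalyticAt.harmonicAt_log_norm (f := fun _ : ℂ => (Real.exp 1 : ℂ)) (z := z)
        analyticAt_const (by simp)
      simpa [Complex.norm_exp] using this
    have := hh.circleAverage_poissonKernel_smul hwmem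
    rw [Real.circleAverage_def] at this
    simpa [hw] using this
  set l : ℝ → ℝ := fun θ => Real.log ‖P.eval (circleMap 0 1 θ)‖ with hl
  have hPc : Continuous fun θ => ‖P.eval (circleMap 0 1 θ)‖ := by fun_prop
  have hPpos : ∀ θ, 0 < ‖P.eval (circleMap 0 1 θ)‖ := fun θ => norm_pos_iff.2 (hP _ (hce θ))
  have hlc : Continuous l := hPc.log (fun θ => (hPpos θ).ne')
  have hwl : k * Real.log r + 2 * Real.log M ≤
      2 * ((2 * Real.pi)⁻¹ * ∫ θ in (0:ℝ)..(2 * Real.pi), w θ * l θ) := by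
    rw [Real.circleAverage_def] at hpl
    simpa [hw, hl] using hpl
  have hlogr : Real.log r < 0 := Real.log_neg hr0 hr1
  have hk' : (1:ℝ) ≤ k := by exact_mod_cast hk
  set L : ℝ := 4 * (k * (- Real.log r)) with hL
  have hLpos : 0 < L := by
    have : 0 < (k:ℝ) * (- Real.log r) := mul_pos (by linarith) (by linarith)
    linarith
  set t : ℝ := r ^ (4 * k) with ht
  have htpos : 0 < t := by positivity
  have hlogt : Real.log t = - L := by
    rw [ht, Real.log_pow, hL]; push_cast; ring
  set h : ℝ → ℝ := fun θ => if f θ < c then (1:ℝ) else 0 with hh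
  have hhm : Measurable h := Measurable.ite (measurableSet_lt hmeas measurable_const)
    measurable_const measurable_const
  have hhi : IntervalIntegrable h volume 0 (2 * Real.pi) := by
    refine IntervalIntegrable.mono_fun (g := h) (f := fun _ => (1:ℝ)) (by simp)
      hhm.aestronglyMeasurable ?_
    refine Filter.Eventually.of_forall fun θ => ?_
    simp only [hh]; split_ifs <;> simp
  have hwhi : IntervalIntegrable (fun θ => w θ * h θ) volume 0 (2 * Real.pi) :=
    hhi.continuousOn_mul hwc.continuousOn
  have hfi : IntervalIntegrable f volume 0 (2 * Real.pi) := by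
    refine IntervalIntegrable.mono_fun (g := f) (f := fun _ => Cf) (by simp)
      hmeas.aestronglyMeasurable ?_
    refine Filter.Eventually.of_forall fun θ => ?_
    show ‖f θ‖ ≤ ‖Cf‖
    rw [Real.norm_eq_abs, Real.norm_eq_abs]
    exact (hCf θ).trans (le_abs_self _)
  have hfPi : IntervalIntegrable (fun θ => f θ * ‖P.eval (circleMap 0 1 θ)‖ ^ 2)
      volume 0 (2 * Real.pi) := hfi.mul_continuousOn (hPc.pow 2).continuousOn
  have hwhle : ∫ θ in (0:ℝ)..(2 * Real.pi), w θ * h θ ≤ 2 * Real.pi / 4 := by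
    calc ∫ θ in (0:ℝ)..(2 * Real.pi), w θ * h θ ≤ ∫ θ in (0:ℝ)..(2 * Real.pi), B * h θ := by
          apply intervalIntegral.integral_mono_on (by positivity) hwhi (hhi.const_mul B)
          intro θ _
          apply mul_le_mul_of_nonneg_right (hwB θ)
          simp only [hh]; split_ifs <;> simp
      _ = B * ∫ θ in (0:ℝ)..(2 * Real.pi), h θ := by
          rw [intervalIntegral.integral_const_mul]
      _ ≤ B * (2 * Real.pi / (4 * B)) := by gcongr
      _ = 2 * Real.pi / 4 := by field_simp
  -- the main pointwise inequality
  have hpt : ∀ θ, 0 < f θ → c * t / B * M ^ 2 *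
      (w θ - w θ * h θ + 2 / L * (w θ * l θ) - 2 * Real.log M / L * w θ)
      ≤ f θ * ‖P.eval (circleMap 0 1 θ)‖ ^ 2 := by
    intro θ hfθ
    have hlM : l θ ≤ Real.log M := Real.log_le_log (hPpos θ) (hmax _ (hce θ))
    have e1 : w θ - w θ * h θ + 2 / L * (w θ * l θ) - 2 * Real.log M / L * w θ =
      w θ * (1 - h θ + 2 * (l θ - Real.log M) / L) := by field_simp; ring
    have hneg : 2 * (l θ - Real.log M) / L ≤ 0 :=
      div_nonpos_of_nonpos_of_nonneg (by linarith) hLpos.le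
    have hrhs : 0 ≤ f θ * ‖P.eval (circleMap 0 1 θ)‖ ^ 2 := by positivity
    have hcoef : 0 ≤ c * t / B * M ^ 2 := by positivity
    rw [e1]
    by_cases hfc : f θ < c
    · have : h θ = 1 := by simp [hh, hfc]
      refine le_trans ?_ hrhs
      refine mul_nonpos_of_nonneg_of_nonpos hcoef (mul_nonpos_of_nonneg_of_nonpos (hw0 θ) ?_)
      rw [this]; linarith
    · have hh0 : h θ = 0 := by simp [hh, hfc]
      push Not at hfc
      by_cases hx : ‖P.eval (circleMap 0 1 θ)‖ ^ 2 < t * M ^ 2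
      · refine le_trans ?_ hrhs
        refine mul_nonpos_of_nonneg_of_nonpos hcoef (mul_nonpos_of_nonneg_of_nonpos (hw0 θ) ?_)
        have hx' := Real.log_le_log (by have := hPpos θ; positivity) hx.le
        rw [Real.log_mul htpos.ne' (by positivity), hlogt, Real.log_pow, Real.log_pow] at hx'
        push_cast at hx'
        have : 2 * (l θ - Real.log M) / L ≤ -1 := by
          rw [div_le_iff₀ hLpos]; simp only [hl]; linarith
        rw [hh0]; linarith
      · push Not at hx
        calc c * t / B * M ^ 2 * (w θ * (1 - h θ + 2 * (l θ - Real.log M) / L))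
            ≤ c * t / B * M ^ 2 * (B * 1) := by
              refine mul_le_mul_of_nonneg_left ?_ hcoef
              refine (mul_le_mul_of_nonneg_left (b := _) (c := 1) ?_ (hw0 θ)).trans ?_
              · rw [hh0]; linarith
              · nlinarith [hwB θ]
          _ = c * (t * M ^ 2) := by field_simp
          _ ≤ _ := mul_le_mul hfc hx (by positivity) hfθ.le
  have hi1 : IntervalIntegrable w volume 0 (2 * Real.pi) := hwc.intervalIntegrable _ _
  have hi3 : IntervalIntegrable (fun θ => 2 / L * (w θ * l θ)) volume 0 (2 * Real.pi) :=
    Continuous.intervalIntegrable (by fun_prop) _ _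
  have hi4 : IntervalIntegrable (fun θ => 2 * Real.log M / L * w θ) volume 0 (2 * Real.pi) :=
    Continuous.intervalIntegrable (by fun_prop) _ _
  have hmono : ∫ θ in (0:ℝ)..(2 * Real.pi), c * t / B * M ^ 2 *
      (w θ - w θ * h θ + 2 / L * (w θ * l θ) - 2 * Real.log M / L * w θ) ≤
      ∫ θ in (0:ℝ)..(2 * Real.pi), f θ * ‖P.eval (circleMap 0 1 θ)‖ ^ 2 := by
    apply intervalIntegral.integral_mono_ae_restrict (by positivity)
    · exact (((hi1.sub hwhi).add hi3).sub hi4).const_mul _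
    · exact hfPi
    · rw [restrict_Ioo_eq_restrict_Icc] at hpos
      filter_upwards [hpos] with θ hθ using hpt θ hθ
  rw [intervalIntegral.integral_const_mul, intervalIntegral.integral_sub ((hi1.sub hwhi).add hi3) hi4,
    intervalIntegral.integral_add (hi1.sub hwhi) hi3, intervalIntegral.integral_sub hi1 hwhi,
    intervalIntegral.integral_const_mul, intervalIntegral.integral_const_mul] at hmono
  set I1 := ∫ θ in (0:ℝ)..(2 * Real.pi), w θ
  set I2 := ∫ θ in (0:ℝ)..(2 * Real.pi), w θ * h θ
  set I3 := ∫ θ in (0:ℝ)..(2 * Real.pi), w θ * l θ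
  have hI1 : I1 = 2 * Real.pi := by field_simp at hw1; linarith
  have hI3 : 2 * Real.pi * (k * Real.log r + 2 * Real.log M) ≤ 2 * I3 := by
    have e : 2 * I3 = 2 * Real.pi * (2 * ((2 * Real.pi)⁻¹ * I3)) := by field_simp
    rw [e]; gcongr
  have hkey : Real.pi ≤ I1 - I2 + 2 / L * I3 - 2 * Real.log M / L * I1 := by
    have e2 : 2 / L * I3 - 2 * Real.log M / L * I1 =
        (2 * I3 - 2 * Real.pi * (2 * Real.log M)) / L := by rw [hI1]; field_simp
    have e3 : -(2 * Real.pi) / 4 ≤ (2 * I3 - 2 * Real.pi * (2 * Real.log M)) / L := by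
      rw [le_div_iff₀ hLpos, hL]; linarith
    linarith
  calc c / (2 * B) * t * M ^ 2 = (2 * Real.pi)⁻¹ * (c * t / B * M ^ 2 * Real.pi) := by
        field_simp
    _ ≤ (2 * Real.pi)⁻¹ * (c * t / B * M ^ 2 *
        (I1 - I2 + 2 / L * I3 - 2 * Real.log M / L * I1)) := by gcongr
    _ ≤ _ := by gcongr

open Polynomial in
/-- The polynomial with coefficient vector `v`. -/
noncomputable def vecPoly {k : ℕ} (v : Fin (k + 1) → ℂ) : ℂ[X] :=
  ∑ i : Fin (k + 1), C (v i) * X ^ (i : ℕ)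

open Polynomial in
lemma vecPoly_eval {k : ℕ} (v : Fin (k + 1) → ℂ) (z : ℂ) :
    (vecPoly v).eval z = ∑ i : Fin (k + 1), v i * z ^ (i : ℕ) := by
  simp [vecPoly, eval_finsetSum]

open Polynomial in
lemma vecPoly_natDegree {k : ℕ} (v : Fin (k + 1) → ℂ) : (vecPoly v).natDegree ≤ k := by
  apply natDegree_sum_le_of_forall_le
  intro i _
  exact (natDegree_C_mul_X_pow_le _ _).trans (by omega)

lemma quad_form (f : ℝ → ℝ) (hmeas : Measurable f)
    (hbd : ∃ C : ℝ, ∀ θ : ℝ, |f θ| ≤ C) (k : ℕ) (v : Fin (k + 1) → ℂ) :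
    (dotProduct (star v) ((toeplitzMatR f k).mulVec v)).re =
      (2 * Real.pi)⁻¹ * ∫ θ in (0:ℝ)..(2 * Real.pi),
        f θ * ‖(vecPoly v).eval (circleMap 0 1 θ)‖ ^ 2 := by
  obtain ⟨Cf, hCf⟩ := hbd
  have hfi : IntervalIntegrable (fun θ => (f θ : ℂ)) volume 0 (2 * Real.pi) := by
    refine IntervalIntegrable.mono_fun (g := fun θ => (f θ : ℂ)) (f := fun _ => Cf) (by simp)
      (by fun_prop) ?_
    refine Filter.Eventually.of_forall fun θ => ?_
    show ‖(f θ : ℂ)‖ ≤ ‖Cf‖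
    rw [Complex.norm_real, Real.norm_eq_abs, Real.norm_eq_abs]
    exact (hCf θ).trans (le_abs_self _)
  have hcomp : dotProduct (star v) ((toeplitzMatR f k).mulVec v) =
      ((2 * Real.pi)⁻¹ * ∫ θ in (0:ℝ)..(2 * Real.pi),
        f θ * ‖(vecPoly v).eval (circleMap 0 1 θ)‖ ^ 2 : ℝ) := by
    rw [Complex.ofReal_mul, ← intervalIntegral.integral_ofReal]
    have hterm : ∀ θ : ℝ, ((f θ * ‖(vecPoly v).eval (circleMap 0 1 θ)‖ ^ 2 : ℝ) : ℂ) =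
        ∑ p : Fin (k + 1), ∑ q : Fin (k + 1), star (v p) * v q *
          ((f θ : ℂ) * Complex.exp (-(Complex.I * (((p : ℤ) - (q : ℤ) : ℤ) : ℂ) * (θ : ℂ)))) := by
      intro θ
      push_cast
      rw [← Complex.conj_mul', vecPoly_eval, map_sum, Finset.sum_mul_sum, Finset.mul_sum]
      refine Finset.sum_congr rfl fun p _ => ?_
      rw [Finset.mul_sum]
      refine Finset.sum_congr rfl fun q _ => ?_
      have e1 : (circleMap 0 1 θ) = Complex.exp (θ * Complex.I) := by simp [circleMap]
      have e2 : Complex.exp (-(Complex.I * ((p : ℂ) - (q : ℂ)) * (θ : ℂ))) =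
          (starRingEnd ℂ (Complex.exp (θ * Complex.I))) ^ (p : ℕ) *
          (Complex.exp (θ * Complex.I)) ^ (q : ℕ) := by
        rw [← Complex.exp_conj, ← Complex.exp_nat_mul, ← Complex.exp_nat_mul, ← Complex.exp_add]
        congr 1
        simp
        ring
      simp only [Int.cast_natCast, Complex.star_def]
      rw [e1, map_mul, map_pow, e2]
      ring
    simp_rw [hterm]
    have hii : ∀ p q : Fin (k + 1), IntervalIntegrable (fun θ : ℝ => star (v p) * v q *
          ((f θ : ℂ) * Complex.exp (-(Complex.I * (((p : ℤ) - (q : ℤ) : ℤ) : ℂ) * (θ : ℂ)))))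
          volume 0 (2 * Real.pi) := by
      intro p q
      apply IntervalIntegrable.const_mul
      apply hfi.mul_continuousOn
      fun_prop
    rw [intervalIntegral.integral_finsetSum (fun p _ => by
      have := IntervalIntegrable.sum Finset.univ (fun q _ => hii p q)
      have e : (∑ q : Fin (k + 1), fun θ : ℝ => star (v p) * v q *
          ((f θ : ℂ) * Complex.exp (-(Complex.I * (((p : ℤ) - (q : ℤ) : ℤ) : ℂ) * (θ : ℂ))))) =
          fun θ : ℝ => ∑ q : Fin (k + 1), star (v p) * v q *
          ((f θ : ℂ) * Complex.exp (-(Complex.I * (((p : ℤ) - (q : ℤ) : ℤ) : ℂ) * (θ : ℂ)))) := by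
        funext θ; rw [Finset.sum_apply]
      rwa [e] at this)]
    rw [dotProduct, Finset.mul_sum]
    refine Finset.sum_congr rfl fun p _ => ?_
    rw [intervalIntegral.integral_finsetSum (fun q _ => hii p q), Matrix.mulVec, dotProduct,
      Finset.mul_sum, Finset.mul_sum]
    refine Finset.sum_congr rfl fun q _ => ?_
    rw [intervalIntegral.integral_const_mul]
    simp only [toeplitzMatR, Matrix.of_apply, fourierCoefR, Pi.star_apply]
    push_cast
    rw [one_div]
    ring
  rw [hcomp, Complex.ofReal_re]

lemma fourierCoefR_one (j : ℤ) : fourierCoefR (fun _ => 1) j = if j = 0 then 1 else 0 := by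
  unfold fourierCoefR
  have hpi := Real.pi_pos
  split_ifs with h
  · subst h
    have : (Real.pi : ℂ) ≠ 0 := by exact_mod_cast hpi.ne'
    simp
    field_simp
  · have hj : -(Complex.I * (j:ℂ)) ≠ 0 := by simp [h]
    have : ∫ θ in (0:ℝ)..(2 * Real.pi), ((1:ℝ):ℂ) * Complex.exp (-(Complex.I * (j : ℂ) * (θ : ℂ)))
        = 0 := by
      have e := integral_exp_mul_complex (a := 0) (b := 2 * Real.pi) hj
      simp only [Complex.ofReal_one, one_mul]
      simp only [neg_mul] at e
      rw [e]
      have e2 : Complex.exp (-(Complex.I * (j:ℂ) * ((2 * Real.pi : ℝ) : ℂ))) = 1 := by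
        rw [Complex.exp_eq_one_iff]
        exact ⟨-j, by push_cast; ring⟩
      rw [e2]; simp
    rw [this, mul_zero]

lemma toeplitz_one (k : ℕ) : toeplitzMatR (fun _ => 1) k = 1 := by
  ext p q
  simp only [toeplitzMatR, Matrix.of_apply, fourierCoefR_one, Matrix.one_apply]
  congr 1
  rw [sub_eq_zero, Nat.cast_inj, Fin.val_inj]

lemma sum_sq_le_max {k : ℕ} (v : Fin (k + 1) → ℂ) (M : ℝ)
    (hM : ∀ z : ℂ, ‖z‖ = 1 → ‖(vecPoly v).eval z‖ ≤ M) : ∑ i, ‖v i‖ ^ 2 ≤ M ^ 2 := by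
  have h := quad_form (fun _ => 1) measurable_const ⟨1, by simp⟩ k v
  have hpi := Real.pi_pos
  have e : (dotProduct (star v) ((toeplitzMatR (fun _ => 1) k).mulVec v)).re = ∑ i, ‖v i‖ ^ 2 := by
    rw [toeplitz_one, Matrix.one_mulVec, dotProduct, Complex.re_sum]
    refine Finset.sum_congr rfl fun i _ => ?_
    rw [Pi.star_apply, Complex.star_def, Complex.conj_mul']
    norm_cast
  rw [e] at h
  rw [h]
  have hc : Continuous fun θ => (1:ℝ) * ‖(vecPoly v).eval (circleMap 0 1 θ)‖ ^ 2 := by fun_prop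
  have : ∫ θ in (0:ℝ)..(2 * Real.pi), (1:ℝ) * ‖(vecPoly v).eval (circleMap 0 1 θ)‖ ^ 2 ≤
      ∫ θ in (0:ℝ)..(2 * Real.pi), M ^ 2 := by
    apply intervalIntegral.integral_mono_on (by positivity) (hc.intervalIntegrable _ _) (by simp)
    intro θ _
    rw [one_mul]
    gcongr
    exact hM _ (by simp)
  rw [intervalIntegral.integral_const, smul_eq_mul, sub_zero] at this
  calc _ ≤ (2 * Real.pi)⁻¹ * (2 * Real.pi * M ^ 2) := by gcongr
    _ = M ^ 2 := by field_simp

lemma quad_lower (f : ℝ → ℝ) (hmeas : Measurable f)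
    (hbd : ∃ C : ℝ, ∀ θ : ℝ, |f θ| ≤ C)
    (hpos : ∀ᵐ θ ∂(volume.restrict (Set.Ioo (0 : ℝ) (2 * Real.pi))), 0 < f θ)
    (r : ℝ) (hr0 : 0 < r) (hr1 : r < 1) :
    ∃ c₀ > (0:ℝ), ∀ k : ℕ, 1 ≤ k → ∀ v : Fin (k + 1) → ℂ,
      c₀ * r ^ (4 * k) * ∑ i, ‖v i‖ ^ 2 ≤
        (dotProduct (star v) ((toeplitzMatR f k).mulVec v)).re := by
  obtain ⟨c₀, hc₀, H⟩ := integral_lower f hmeas hbd hpos r hr0 hr1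
  refine ⟨c₀, hc₀, fun k hk => ?_⟩
  -- the case without zeros on the circle
  have hgood : ∀ v : Fin (k + 1) → ℂ, (∀ z : ℂ, ‖z‖ = 1 → (vecPoly v).eval z ≠ 0) →
      c₀ * r ^ (4 * k) * ∑ i, ‖v i‖ ^ 2 ≤
        (dotProduct (star v) ((toeplitzMatR f k).mulVec v)).re := by
    intro v hv
    obtain ⟨z₀, hz₀, hmax⟩ := (isCompact_sphere (0:ℂ) 1).exists_isMaxOn
      ⟨1, by simp⟩ (f := fun z => ‖(vecPoly v).eval z‖) (by fun_prop)
    have hz₀' : ‖z₀‖ = 1 := by simpa using hz₀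
    have hmax' : ∀ z : ℂ, ‖z‖ = 1 → ‖(vecPoly v).eval z‖ ≤ ‖(vecPoly v).eval z₀‖ :=
      fun z hz => hmax (by simpa using hz)
    rw [quad_form f hmeas hbd]
    refine le_trans ?_ (H k hk (vecPoly v) (vecPoly_natDegree v) hv z₀ hz₀' hmax')
    gcongr
    exact sum_sq_le_max v _ hmax'
  intro v
  by_cases hv0 : vecPoly v = 0
  · have h0 := sum_sq_le_max v 0 (by simp [hv0])
    have h1 : ∑ i, ‖v i‖ ^ 2 = 0 :=
      le_antisymm (by simpa using h0) (Finset.sum_nonneg fun i _ => by positivity)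
    rw [h1, quad_form f hmeas hbd, hv0]
    simp
  set u : ℝ → Fin (k + 1) → ℂ := fun s i => v i * (s : ℂ) ^ (i : ℕ) with hu
  have hu1 : u 1 = v := by funext i; simp [hu]
  have huc : Continuous u := by
    apply continuous_pi; intro i; fun_prop
  have hue : ∀ s : ℝ, ∀ z : ℂ, (vecPoly (u s)).eval z = (vecPoly v).eval (s * z) := by
    intro s z
    simp only [vecPoly_eval, hu, mul_pow]
    exact Finset.sum_congr rfl fun i _ => by ring
  set bad : Set ℝ := (fun a : ℂ => ‖a‖) '' {a | a ∈ (vecPoly v).roots} \ {1} with hbad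
  have hfin : bad.Finite := by
    apply Set.Finite.diff
    apply Set.Finite.image
    exact ((vecPoly v).roots.toFinset.finite_toSet).subset (fun a ha => by simpa using ha)
  have hev : ∀ᶠ s in nhdsWithin (1:ℝ) {1}ᶜ, c₀ * r ^ (4 * k) * ∑ i, ‖u s i‖ ^ 2 ≤
        (dotProduct (star (u s)) ((toeplitzMatR f k).mulVec (u s))).re := by
    have h1 : ∀ᶠ s in nhds (1:ℝ), s ∉ bad :=
      hfin.isClosed.isOpen_compl.mem_nhds (by simp [hbad])
    have h2 : ∀ᶠ s in nhds (1:ℝ), 0 < s := lt_mem_nhds one_pos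
    filter_upwards [nhdsWithin_le_nhds h1, nhdsWithin_le_nhds h2, self_mem_nhdsWithin]
      with s hs1 hs2 hs3
    apply hgood
    intro z hz h0
    rw [hue] at h0
    apply hs1
    refine ⟨⟨(s * z : ℂ), (Polynomial.mem_roots hv0).2 h0, ?_⟩, hs3⟩
    simp [hz, abs_of_pos hs2]
  have hT1 : Continuous fun s => c₀ * r ^ (4 * k) * ∑ i, ‖u s i‖ ^ 2 := by fun_prop
  have hT2 : Continuous fun s =>
      (dotProduct (star (u s)) ((toeplitzMatR f k).mulVec (u s))).re := by
    have : Continuous fun s => (toeplitzMatR f k).mulVec (u s) :=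
      continuous_const.matrix_mulVec huc
    exact Complex.continuous_re.comp (huc.star.dotProduct this)
  have := le_of_tendsto_of_tendsto ((hT1.tendsto 1).mono_left nhdsWithin_le_nhds)
    ((hT2.tendsto 1).mono_left nhdsWithin_le_nhds) hev
  simpa only [hu1] using this

/-- If `f > 0` a.e. on the circle, then the smallest eigenvalue of the Toeplitz matrix
`T_k[a]` decays subexponentially: for every `ε > 0` there is `k₀` such that
`exp(-ε k) ≤ λ_min(T_k[a]) ≤ exp(ε k)` for all `k ≥ k₀`. -/
theorem toeplitz_lambdaMin_subexponential (f : ℝ → ℝ) (hmeas : Measurable f)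
    (hbd : ∃ C : ℝ, ∀ θ : ℝ, |f θ| ≤ C)
    (hpos : ∀ᵐ θ ∂(volume.restrict (Set.Ioo (0 : ℝ) (2 * Real.pi))), 0 < f θ) :
    ∀ ε > (0 : ℝ), ∃ k₀ : ℕ, ∀ k ≥ k₀,
      Real.exp (-ε * k) ≤ lambdaMin (toeplitzMatR f k) ∧
        lambdaMin (toeplitzMatR f k) ≤ Real.exp (ε * k) := by
  intro ε hε
  set r : ℝ := Real.exp (-ε / 8) with hr
  have hr0 : 0 < r := Real.exp_pos _
  have hr1 : r < 1 := by rw [hr, Real.exp_lt_one_iff]; linarith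
  obtain ⟨c₀, hc₀, H⟩ := quad_lower f hmeas hbd hpos r hr0 hr1
  obtain ⟨Cf, hCf⟩ := hbd
  have htend : Filter.Tendsto (fun k : ℕ => Real.exp (ε / 2 * k)) Filter.atTop Filter.atTop :=
    Real.tendsto_exp_atTop.comp
      (Filter.Tendsto.const_mul_atTop (by positivity) tendsto_natCast_atTop_atTop)
  obtain ⟨k₀, hk₀⟩ := Filter.eventually_atTop.1
    ((htend.eventually_ge_atTop (1 / c₀)).and ((htend.eventually_ge_atTop Cf).and
      (Filter.eventually_ge_atTop 1)))
  refine ⟨k₀, fun k hk => ?_⟩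
  obtain ⟨h1, h2, hk1⟩ := hk₀ k hk
  have hlow : Real.exp (-ε * k) ≤ c₀ * r ^ (4 * k) := by
    have e1 : r ^ (4 * k) = Real.exp (-ε * k) * Real.exp (ε / 2 * k) := by
      rw [hr, ← Real.exp_nat_mul, ← Real.exp_add]
      congr 1; push_cast; ring
    rw [e1]
    have : 1 ≤ c₀ * Real.exp (ε / 2 * k) := by
      rw [div_le_iff₀ hc₀] at h1; linarith
    nlinarith [Real.exp_pos (-ε * k)]
  have hlb : ∀ t ∈ {t : ℝ | ∃ v : Fin (k + 1) → ℂ, (∑ i, ‖v i‖ ^ 2) = 1 ∧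
      t = (dotProduct (star v) ((toeplitzMatR f k).mulVec v)).re}, Real.exp (-ε * k) ≤ t := by
    rintro t ⟨v, hv, rfl⟩
    have := H k hk1 v
    rw [hv, mul_one] at this
    exact hlow.trans this
  have hmem : (dotProduct (star (Pi.single (0 : Fin (k + 1)) (1:ℂ)))
      ((toeplitzMatR f k).mulVec (Pi.single 0 1))).re ∈
      {t : ℝ | ∃ v : Fin (k + 1) → ℂ, (∑ i, ‖v i‖ ^ 2) = 1 ∧
      t = (dotProduct (star v) ((toeplitzMatR f k).mulVec v)).re} := by
    refine ⟨Pi.single 0 1, ?_, rfl⟩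
    rw [Finset.sum_eq_single 0]
    · simp
    · intro b _ hb; simp [hb]
    · simp
  constructor
  · exact le_csInf ⟨_, hmem⟩ hlb
  · refine (csInf_le ⟨_, hlb⟩ hmem).trans ?_
    have hpi := Real.pi_pos
    have hev : ∀ θ : ℝ, (vecPoly (Pi.single (0 : Fin (k + 1)) (1:ℂ))).eval (circleMap 0 1 θ) = 1 := by
      intro θ
      rw [vecPoly_eval, Finset.sum_eq_single 0]
      · simp
      · intro b _ hb; simp [hb]
      · simp
    rw [quad_form f hmeas ⟨Cf, hCf⟩]
    simp only [hev, norm_one, one_pow, mul_one]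
    have hb : ‖∫ θ in (0:ℝ)..(2 * Real.pi), f θ‖ ≤ Cf * |2 * Real.pi - 0| :=
      intervalIntegral.norm_integral_le_of_norm_le_const (fun θ _ => hCf θ)
    rw [sub_zero, abs_of_pos (by positivity), Real.norm_eq_abs] at hb
    have hb' := (le_abs_self _).trans hb
    calc (2 * Real.pi)⁻¹ * ∫ θ in (0:ℝ)..(2 * Real.pi), f θ
        ≤ (2 * Real.pi)⁻¹ * (Cf * (2 * Real.pi)) := by gcongr
      _ = Cf := by field_simp
      _ ≤ Real.exp (ε / 2 * k) := h2
      _ ≤ Real.exp (ε * k) := by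
          gcongr; linarith
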